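/- Matching derivatives characterization of discrete splines: let k ≥ 0 and n ≥ k+2. (i) Every f ∈ H^k_n satisfies (Δ^k_n f)(x) = (D^k f)(x) for all x ∈ (x_k, b], where D^k f denotes the k-th derivative of f, taken as the k-th left derivative at points where it does not exist. (ii) Conversely, if f is a k-th degree piecewise polynomial with knots in x_{(k+1):(n−1)} — meaning f coincides with a polynomial of degree ≤ k on each of the intervals [a, x_{k+1}], (x_i, x_{i+1}] for i = k+1,…,n−2, and (x_{n−1}, b] — and (Δ^k_n f)(x) = (D^k f)(x) for all x ∈ (x_k, b], then f ∈ H^k_n. -/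

import Mathlib

open Finset

/-- Divided difference of `f` with respect to a list of centers:
`f[z] = f z`, and `f[z₁,…,z_{r+1}] = (f[z₂,…,z_{r+1}] − f[z₁,…,z_r]) / (z_{r+1} − z₁)`. -/
noncomputable def divDiff (f : ℝ → ℝ) : List ℝ → ℝ
  | [] => 0
  | [z] => f z
  | z :: y :: l =>
      (divDiff f (y :: l) - divDiff f (z :: (y :: l).dropLast)) /
        ((y :: l).getLast (List.cons_ne_nil y l) - z)
  termination_by l => l.length
  decreasing_by
  · simp
  · simp [List.length_dropLast]

/-- The list of centers `x_lo, …, x_hi`. -/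
noncomputable def ctrs (x : ℕ → ℝ) (lo hi : ℕ) : List ℝ :=
  (List.range (hi + 1 - lo)).map fun m => x (lo + m)

/-- The index `i` such that `t ∈ (x_i, x_{i+1}]` (equals `0` when `t ≤ x 1`,
and `n` when `t > x n`): the number of design points strictly below `t`. -/
noncomputable def discrIdx (x : ℕ → ℝ) (n : ℕ) (t : ℝ) : ℕ :=
  ((Finset.Icc 1 n).filter fun i => x i < t).card

/-- The `k`-th order discrete derivative operator `Δ^k_n`. -/
noncomputable def discreteDeriv (x : ℕ → ℝ) (n k : ℕ) (f : ℝ → ℝ) (t : ℝ) : ℝ :=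
  let i := discrIdx x n t
  if k ≤ i then (Nat.factorial k : ℝ) * divDiff f (ctrs x (i + 1 - k) i ++ [t])
  else (Nat.factorial i : ℝ) * divDiff f (ctrs x 1 i ++ [t])

/-- The simple cumulative sum operator `S̄(·; x_{lo:n})`. -/
noncomputable def cumSum (x : ℕ → ℝ) (lo n : ℕ) (f : ℝ → ℝ) (t : ℝ) : ℝ :=
  (∑ j ∈ Finset.Icc lo n, if x j < t then f (x j) else 0) + f t

/-- The weight map `W^k_n`. -/
noncomputable def weightMap (x : ℕ → ℝ) (n k : ℕ) (f : ℝ → ℝ) (t : ℝ) : ℝ :=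
  let i := discrIdx x n t
  if k ≤ i then f t * ((t - x (i + 1 - k)) / k) else f t

/-- The `k`-th order discrete integral operator `S^k_n`:
`S^0 = id`, `S^1 = S̄(·;x_{1:n}) ∘ W^1_n`, and `S^k = S^{k-1} ∘ S̄(·;x_{k:n}) ∘ W^k_n`. -/
noncomputable def discreteInteg (x : ℕ → ℝ) (n : ℕ) : ℕ → (ℝ → ℝ) → ℝ → ℝ
  | 0, f => f
  | k + 1, f => discreteInteg x n k (cumSum x (k + 1) n (weightMap x n (k + 1) f))

/-- The `k`-th degree falling factorial basis function `h^k_j`. -/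
noncomputable def fallFact (x : ℕ → ℝ) (k j : ℕ) (t : ℝ) : ℝ :=
  if j ≤ k + 1 then
    (1 / (Nat.factorial (j - 1) : ℝ)) * ∏ ℓ ∈ Finset.Icc 1 (j - 1), (t - x ℓ)
  else
    (1 / (Nat.factorial k : ℝ)) * (∏ ℓ ∈ Finset.Icc (j - k) (j - 1), (t - x ℓ)) *
      (if x (j - 1) < t then 1 else 0)

/-- Membership in `H^k_n`, the span of the falling factorial basis, as functions on `[a,b]`. -/
def inFFSpan (x : ℕ → ℝ) (n k : ℕ) (a b : ℝ) (f : ℝ → ℝ) : Prop :=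
  ∃ c : ℕ → ℝ, ∀ t ∈ Set.Icc a b, f t = ∑ j ∈ Finset.Icc 1 n, c j * fallFact x k j t

/-- Divided difference of data `v_lo, …, v_{lo+d}` over centers `x_lo, …, x_{lo+d}`. -/
noncomputable def divDiffVec (x v : ℕ → ℝ) : ℕ → ℕ → ℝ
  | lo, 0 => v lo
  | lo, d + 1 => (divDiffVec x v (lo + 1) d - divDiffVec x v lo d) / (x (lo + d + 1) - x lo)

/-- Left derivative. -/
noncomputable def lDeriv (f : ℝ → ℝ) : ℝ → ℝ := fun t => derivWithin f (Set.Iic t) t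

/-- `k`-th derivative, taken as the left derivative where the derivative does not exist. -/
noncomputable def Dk (m : ℕ) (f : ℝ → ℝ) : ℝ → ℝ := lDeriv^[m] f

open Polynomial in
theorem aux_deg (q : ℝ[X]) (m : ℕ) (h : q.natDegree ≤ m) : q.degree < ((m + 1 : ℕ) : WithBot ℕ) := by
  rw [degree_lt_iff_coeff_zero]
  intro j hj
  exact coeff_eq_zero_of_natDegree_lt (by omega)

open Polynomial in
theorem aux_interp (f : ℝ → ℝ) : ∀ (m : ℕ) (L : List ℝ), L.length = m + 1 → L.Nodup →
    ∃ q : ℝ[X], q.natDegree ≤ m ∧ (∀ z ∈ L, f z = q.eval z) ∧ divDiff f L = q.coeff m := by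
  intro m
  induction m with
  | zero =>
    intro L hL hN
    obtain ⟨z, rfl⟩ := List.length_eq_one_iff.1 hL
    refine ⟨C (f z), by simp, by simp, ?_⟩
    simp [divDiff]
  | succ m ih =>
    intro L hL hN
    match L, hL, hN with
    | z :: y :: l, hL, hN =>
      rw [divDiff]
      set w := (y :: l).getLast (List.cons_ne_nil y l) with hw
      have hd : (y :: l).dropLast ++ [w] = y :: l := List.dropLast_append_getLast _
      have hN1 : (y :: l).Nodup := (List.nodup_cons.1 hN).2
      have hz : z ∉ y :: l := (List.nodup_cons.1 hN).1
      have hN2 : (z :: (y :: l).dropLast).Nodup := by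
        refine List.nodup_cons.2 ⟨fun h => hz (List.mem_of_mem_dropLast h), ?_⟩
        exact hN1.sublist (List.dropLast_sublist _)
      have hwm : w ∈ y :: l := List.getLast_mem _
      have hwz : w - z ≠ 0 := by
        intro h
        apply hz
        rw [← sub_eq_zero.1 h]; exact hwm
      have hl1 : (y :: l).length = m + 1 := by simpa using hL
      obtain ⟨q1, d1, e1, c1⟩ := ih (y :: l) hl1 hN1
      obtain ⟨q2, d2, e2, c2⟩ := ih (z :: (y :: l).dropLast)
        (by rw [List.length_cons, List.length_dropLast, hl1]; simp) hN2
      refine ⟨C (w - z)⁻¹ * ((X - C z) * q1 - (X - C w) * q2), ?_, ?_, ?_⟩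
      · refine (natDegree_C_mul_le _ _).trans ?_
        refine (natDegree_sub_le _ _).trans (max_le ?_ ?_)
        · refine natDegree_mul_le.trans ?_
          rw [natDegree_X_sub_C]; omega
        · refine natDegree_mul_le.trans ?_
          rw [natDegree_X_sub_C]; omega
      · intro u hu
        simp only [eval_mul, eval_sub, eval_C, eval_X]
        rw [List.mem_cons] at hu
        rcases hu with rfl | hu
        · rw [← e2 u (by simp)]; field_simp; ring
        · rw [← e1 u hu]
          rw [← hd, List.mem_append] at hu
          rcases hu with hu | hu
          · rw [← e2 u (List.mem_cons_of_mem _ hu)]; field_simp; ring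
          · rw [List.mem_singleton] at hu
            subst hu
            field_simp; ring
      · rw [c1, c2, coeff_C_mul]
        have h1 : q1.coeff (m + 1) = 0 := coeff_eq_zero_of_natDegree_lt (by omega)
        have h2 : q2.coeff (m + 1) = 0 := coeff_eq_zero_of_natDegree_lt (by omega)
        simp only [sub_mul, coeff_sub, coeff_X_mul, coeff_C_mul, h1, h2]
        field_simp; ring

open Polynomial in
theorem aux_unique (L : List ℝ) (hN : L.Nodup) (p q : ℝ[X]) (hp : p.degree < L.length)
    (hq : q.degree < L.length) (h : ∀ z ∈ L, p.eval z = q.eval z) : p = q := by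
  have hc : L.toFinset.card = L.length := List.toFinset_card_of_nodup hN
  apply eq_of_degrees_lt_of_eval_finset_eq L.toFinset
  · rw [hc]; exact hp
  · rw [hc]; exact hq
  · intro z hz; exact h z (List.mem_toFinset.1 hz)

open Polynomial in
theorem aux_divDiff_poly (f : ℝ → ℝ) (m : ℕ) (L : List ℝ) (hL : L.length = m + 1) (hN : L.Nodup)
    (q : ℝ[X]) (hq : q.natDegree ≤ m) (h : ∀ z ∈ L, f z = q.eval z) :
    divDiff f L = q.coeff m := by
  obtain ⟨r, d, e, c⟩ := aux_interp f m L hL hN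
  rw [c]
  have : r = q := by
    apply aux_unique L hN
    · rw [hL]; exact aux_deg _ _ (by omega)
    · rw [hL]; exact aux_deg _ _ (by omega)
    · intro z hz; rw [← e z hz, h z hz]
  rw [this]

open Polynomial in
theorem aux_lDeriv (f : ℝ → ℝ) (q : ℝ[X]) (c d : ℝ) (h : ∀ s ∈ Set.Ioc c d, f s = q.eval s) :
    ∀ s ∈ Set.Ioc c d, lDeriv f s = (derivative q).eval s := by
  intro s hs
  unfold lDeriv
  have he : f =ᶠ[nhdsWithin s (Set.Iic s)] fun u => q.eval u := by
    filter_upwards [Ioc_mem_nhdsLE hs.1] with u hu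
    exact h u ⟨hu.1, hu.2.trans hs.2⟩
  rw [he.derivWithin_eq (h s hs)]
  exact ((q.hasDerivAt s).hasDerivWithinAt).derivWithin (uniqueDiffWithinAt_Iic s)

open Polynomial in
theorem aux_Dk (c d : ℝ) (m : ℕ) : ∀ (f : ℝ → ℝ) (q : ℝ[X]), (∀ s ∈ Set.Ioc c d, f s = q.eval s) →
    ∀ s ∈ Set.Ioc c d, Dk m f s = (derivative^[m] q).eval s := by
  induction m with
  | zero => intro f q h; simpa [Dk] using h
  | succ m ih =>
    intro f q h s hs
    have := ih (lDeriv f) (derivative q) (aux_lDeriv f q c d h) s hs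
    simpa [Dk] using this

open Polynomial in
theorem aux_Dk_coeff (c d : ℝ) (k : ℕ) (f : ℝ → ℝ) (q : ℝ[X]) (hq : q.natDegree ≤ k)
    (h : ∀ s ∈ Set.Ioc c d, f s = q.eval s) (s : ℝ) (hs : s ∈ Set.Ioc c d) :
    Dk k f s = (Nat.factorial k : ℝ) * q.coeff k := by
  rw [aux_Dk c d k f q h s hs]
  have h0 : (derivative^[k] q).natDegree = 0 := by
    have := natDegree_iterate_derivative q k
    omega
  rw [eq_C_of_natDegree_eq_zero h0, eval_C, coeff_iterate_derivative]
  simp [Nat.descFactorial_self]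

theorem aux_mono (n : ℕ) (x : ℕ → ℝ) (hmono : ∀ i, 1 ≤ i → i < n → x i < x (i + 1)) :
    ∀ i j, 1 ≤ i → i < j → j ≤ n → x i < x j := by
  intro i j hi hij
  induction j, hij using Nat.le_induction with
  | base => intro h; exact hmono i hi h
  | succ j hj ih =>
    intro h
    exact (ih (by omega)).trans (hmono j (by omega) (by omega))

theorem aux_idx (n : ℕ) (x : ℕ → ℝ) (hm : ∀ i j, 1 ≤ i → i < j → j ≤ n → x i < x j)
    (t : ℝ) (j : ℕ) (h1 : 1 ≤ j) (hj : j ≤ n) : x j < t ↔ j ≤ discrIdx x n t := by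
  unfold discrIdx
  constructor
  · intro h
    have : Finset.Icc 1 j ⊆ (Finset.Icc 1 n).filter fun i => x i < t := by
      intro i hi
      rw [Finset.mem_Icc] at hi
      rw [Finset.mem_filter, Finset.mem_Icc]
      refine ⟨⟨hi.1, by omega⟩, ?_⟩
      rcases eq_or_lt_of_le hi.2 with rfl | h'
      · exact h
      · exact (hm i j hi.1 h' hj).trans h
    simpa using Finset.card_le_card this
  · intro h
    by_contra hc
    have : ((Finset.Icc 1 n).filter fun i => x i < t) ⊆ Finset.Icc 1 (j - 1) := by
      intro i hi
      rw [Finset.mem_filter, Finset.mem_Icc] at hi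
      rw [Finset.mem_Icc]
      refine ⟨hi.1.1, ?_⟩
      by_contra h'
      apply hc
      rcases eq_or_lt_of_le (show j ≤ i by omega) with rfl | h''
      · exact hi.2
      · exact (hm j i h1 h'' hi.1.2).trans hi.2
    have := Finset.card_le_card this
    simp only [Nat.card_Icc] at this
    omega

theorem aux_idx_le (n : ℕ) (x : ℕ → ℝ) (t : ℝ) : discrIdx x n t ≤ n := by
  unfold discrIdx
  refine (Finset.card_filter_le _ _).trans ?_
  simp

theorem aux_ctrs_len (x : ℕ → ℝ) (k i : ℕ) (hk : k ≤ i) : (ctrs x (i + 1 - k) i).length = k := by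
  simp [ctrs]; omega

theorem aux_mem_ctrs (x : ℕ → ℝ) (lo hi : ℕ) (z : ℝ) :
    z ∈ ctrs x lo hi ↔ ∃ ℓ, lo ≤ ℓ ∧ ℓ ≤ hi ∧ x ℓ = z := by
  simp only [ctrs, List.mem_map, List.mem_range]
  constructor
  · rintro ⟨m, h, rfl⟩; exact ⟨lo + m, by omega, by omega, rfl⟩
  · rintro ⟨l, h1, h2, rfl⟩; exact ⟨l - lo, by omega, by congr 1; omega⟩

theorem aux_ctrs_nodup (n : ℕ) (x : ℕ → ℝ) (hm : ∀ i j, 1 ≤ i → i < j → j ≤ n → x i < x j)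
    (lo hi : ℕ) (h1 : 1 ≤ lo) (h2 : hi ≤ n) : (ctrs x lo hi).Nodup := by
  unfold ctrs
  refine (List.nodup_map_iff_inj_on List.nodup_range).2 ?_
  intro a ha b hb hab
  rw [List.mem_range] at ha hb
  by_contra hne
  rcases lt_or_gt_of_ne hne with h | h
  · exact absurd hab (hm (lo + a) (lo + b) (by omega) (by omega) (by omega)).ne
  · exact absurd hab.symm (hm (lo + b) (lo + a) (by omega) (by omega) (by omega)).ne

theorem aux_ctrs_nodup' (n : ℕ) (x : ℕ → ℝ) (hm : ∀ i j, 1 ≤ i → i < j → j ≤ n → x i < x j)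
    (lo hi : ℕ) (h1 : 1 ≤ lo) (h2 : hi ≤ n) (t : ℝ) (ht : 1 ≤ hi → x hi < t) :
    (ctrs x lo hi ++ [t]).Nodup := by
  refine List.nodup_append.2 ⟨aux_ctrs_nodup n x hm lo hi h1 h2, by simp, ?_⟩
  intro a ha b hb hab
  rw [List.mem_singleton] at hb
  obtain ⟨l, g1, g2, rfl⟩ := (aux_mem_ctrs x lo hi a).1 ha
  subst hb
  subst hab
  have := ht (by omega)
  rcases eq_or_lt_of_le g2 with rfl | h
  · exact lt_irrefl _ this
  · exact lt_asymm this (hm l hi (by omega) h h2)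

open Polynomial in
/-- nodal polynomial -/
noncomputable def auxN (x : ℕ → ℝ) (lo hi : ℕ) : ℝ[X] := ∏ ℓ ∈ Finset.Icc lo hi, (X - C (x ℓ))

open Polynomial in
theorem auxN_eval (x : ℕ → ℝ) (lo hi : ℕ) (t : ℝ) :
    (auxN x lo hi).eval t = ∏ ℓ ∈ Finset.Icc lo hi, (t - x ℓ) := by
  simp [auxN, eval_prod]

open Polynomial in
theorem auxN_monic (x : ℕ → ℝ) (lo hi : ℕ) : (auxN x lo hi).Monic :=
  monic_prod_of_monic _ _ fun _ _ => monic_X_sub_C _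

open Polynomial in
theorem auxN_deg (x : ℕ → ℝ) (lo hi : ℕ) : (auxN x lo hi).natDegree = hi + 1 - lo := by
  unfold auxN
  rw [natDegree_prod_of_monic _ _ fun _ _ => monic_X_sub_C _]
  simp

open Polynomial in
theorem aux_sub_deg (k : ℕ) (D N : ℝ[X]) (hD : D.natDegree ≤ k) (hN : N.natDegree = k)
    (hm : N.Monic) : (D - C (D.coeff k) * N).degree < k := by
  rw [degree_lt_iff_coeff_zero]
  intro m hkm
  rcases eq_or_lt_of_le hkm with rfl | h
  · have : N.coeff k = 1 := by rw [← hN]; exact hm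
    simp [this]
  · simp [coeff_eq_zero_of_natDegree_lt (show D.natDegree < m by omega),
      coeff_eq_zero_of_natDegree_lt (show N.natDegree < m by omega)]

open Polynomial in
theorem aux_newton (x : ℕ → ℝ) (k : ℕ) : ∀ q : ℝ[X], q.natDegree ≤ k →
    ∃ d : ℕ → ℝ, ∀ t, q.eval t = ∑ j ∈ Finset.Icc 1 (k + 1),
      d j * ((1 / (Nat.factorial (j - 1) : ℝ)) * ∏ ℓ ∈ Finset.Icc 1 (j - 1), (t - x ℓ)) := by
  induction k with
  | zero =>
    intro q hq
    refine ⟨fun _ => q.coeff 0, fun t => ?_⟩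
    rw [eq_C_of_natDegree_le_zero hq]; simp
  | succ k ih =>
    intro q hq
    have h1 := aux_sub_deg (k + 1) q (auxN x 1 (k + 1)) hq (by rw [auxN_deg]; omega) (auxN_monic _ _ _)
    obtain ⟨d, hd⟩ := ih (q - C (q.coeff (k + 1)) * auxN x 1 (k + 1))
      (natDegree_le_iff_degree_le.2 (by
        rw [degree_le_iff_coeff_zero]
        intro m hm
        exact degree_lt_iff_coeff_zero _ _ |>.1 h1 m (by exact_mod_cast hm)))
    refine ⟨fun j => if j = k + 2 then q.coeff (k + 1) * (Nat.factorial (k + 1) : ℝ) else d j,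
      fun t => ?_⟩
    rw [Finset.sum_Icc_succ_top (by omega)]
    have h2 := hd t
    rw [eval_sub, eval_mul, eval_C, auxN_eval, sub_eq_iff_eq_add] at h2
    rw [h2]
    congr 1
    · apply Finset.sum_congr rfl
      intro j hj
      rw [Finset.mem_Icc] at hj
      simp only
      rw [if_neg (by omega)]
    · have : (Nat.factorial (k + 1) : ℝ) ≠ 0 := by positivity
      simp only [Nat.add_sub_cancel, if_true]
      field_simp

theorem aux_discr (n k : ℕ) (x : ℕ → ℝ) (f : ℝ → ℝ) (t : ℝ) (h : k ≤ discrIdx x n t) :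
    discreteDeriv x n k f t = (Nat.factorial k : ℝ) *
      divDiff f (ctrs x (discrIdx x n t + 1 - k) (discrIdx x n t) ++ [t]) := by
  unfold discreteDeriv
  simp only
  rw [if_pos h]

open Polynomial in
/-- polynomial piece of the basis function on `(x_i, x_{i+1}]` -/
noncomputable def auxP (x : ℕ → ℝ) (k i j : ℕ) : ℝ[X] :=
  if j ≤ k + 1 then C (1 / (Nat.factorial (j - 1) : ℝ)) * auxN x 1 (j - 1)
  else if j ≤ i + 1 then C (1 / (Nat.factorial k : ℝ)) * auxN x (j - k) (j - 1) else 0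

open Polynomial in
theorem auxP_deg (x : ℕ → ℝ) (k i j : ℕ) : (auxP x k i j).natDegree ≤ k := by
  unfold auxP
  split_ifs
  · refine (natDegree_C_mul_le _ _).trans ?_
    rw [auxN_deg]; omega
  · refine (natDegree_C_mul_le _ _).trans ?_
    rw [auxN_deg]; omega
  · simp

open Polynomial in
theorem auxP_eval (x : ℕ → ℝ) (k i j : ℕ) (s : ℝ)
    (h : k + 1 < j → (j ≤ i + 1 ↔ x (j - 1) < s) ∨
      ((∃ ℓ, j - k ≤ ℓ ∧ ℓ ≤ j - 1 ∧ x ℓ = s) ∧ j ≤ i + 1) ∨ (¬ j ≤ i + 1 ∧ s ≤ x (j - 1))) :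
    fallFact x k j s = (auxP x k i j).eval s := by
  unfold fallFact auxP
  split_ifs with h1 h2 h3 h3
  · simp [auxN_eval]
  · simp [auxN_eval]
  · rcases h (by omega) with h | ⟨h, h'⟩ | ⟨h, h'⟩
    · exact absurd (h.2 h2) h3
    · exact absurd h' h3
    · exact absurd h2 (not_lt.2 h')
  · rcases h (by omega) with h | ⟨⟨l, g1, g2, rfl⟩, h'⟩ | ⟨h, h'⟩
    · exact absurd (h.1 h3) h2
    · rw [eval_mul, auxN_eval, mul_zero]
      rw [Finset.prod_eq_zero (Finset.mem_Icc.2 ⟨g1, g2⟩) (sub_self _), mul_zero]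
    · exact absurd h3 h
  · simp

open Polynomial in
theorem aux_part1 (n k : ℕ) (a b : ℝ) (x : ℕ → ℝ)
    (hn : k + 2 ≤ n) (hm : ∀ i j, 1 ≤ i → i < j → j ≤ n → x i < x j)
    (ha : a ≤ x 1) (f : ℝ → ℝ) (hf : inFFSpan x n k a b f) (t : ℝ) (hk : x k < t) (ht : t ≤ b) :
    discreteDeriv x n k f t = Dk k f t := by
  rcases Nat.eq_zero_or_pos k with rfl | hk0
  · rw [aux_discr _ _ _ _ _ (Nat.zero_le _)]
    simp [ctrs, divDiff, Dk]
  obtain ⟨c, hc⟩ := hf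
  have hidx := aux_idx n x hm t
  have hin := aux_idx_le n x t
  have hki : k ≤ discrIdx x n t := (hidx k hk0 (by omega)).1 hk
  rw [aux_discr _ _ _ _ _ hki]
  generalize discrIdx x n t = i at hidx hin hki
  have hm1 : ∀ l, 1 ≤ l → l ≤ n → a ≤ x l := by
    intro l h1 h2
    rcases eq_or_lt_of_le h1 with rfl | h
    · exact ha
    · exact ha.trans (hm 1 l le_rfl h h2).le
  have hxi : x i < t := (hidx i (by omega) hin).2 le_rfl
  have hle : ∀ l l', 1 ≤ l → l ≤ l' → l' ≤ n → x l ≤ x l' := by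
    intro l l' h1 h2 h3
    rcases eq_or_lt_of_le h2 with rfl | h
    · exact le_rfl
    · exact (hm l l' h1 h h3).le
  set q : ℝ[X] := ∑ j ∈ Finset.Icc 1 n, C (c j) * auxP x k i j with hq
  have hqd : q.natDegree ≤ k := by
    refine natDegree_sum_le_of_forall_le _ _ fun j _ => ?_
    exact (natDegree_C_mul_le _ _).trans (auxP_deg _ _ _ _)
  have hqI : ∀ s ∈ Set.Ioc (x i) t, f s = q.eval s := by
    intro s hs
    rw [hc s ⟨(hm1 i (by omega) hin).trans hs.1.le, hs.2.trans ht⟩, hq, eval_finset_sum]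
    apply Finset.sum_congr rfl
    intro j hj
    rw [Finset.mem_Icc] at hj
    rw [eval_mul, eval_C, auxP_eval x k i j s]
    intro hkj
    left
    constructor
    · intro h
      exact (hle (j - 1) i (by omega) (by omega) hin).trans_lt hs.1
    · intro h
      have := (hidx (j - 1) (by omega) (by omega)).1 (h.trans_le hs.2)
      omega
  have hqC : ∀ z ∈ ctrs x (i + 1 - k) i ++ [t], f z = q.eval z := by
    intro z hz
    rw [List.mem_append, List.mem_singleton] at hz
    rcases hz with hz | rfl
    · obtain ⟨l, h1, h2, rfl⟩ := (aux_mem_ctrs _ _ _ _).1 hz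
      have hl1 : x l ≤ x i := hle l i (by omega) h2 hin
      rw [hc (x l) ⟨hm1 l (by omega) (by omega), hl1.trans (hxi.le.trans ht)⟩, hq, eval_finset_sum]
      apply Finset.sum_congr rfl
      intro j hj
      rw [Finset.mem_Icc] at hj
      rw [eval_mul, eval_C, auxP_eval x k i j (x l)]
      intro hkj
      by_cases hji : j ≤ i + 1
      · by_cases hl : l ≤ j - 1
        · exact Or.inr (Or.inl ⟨⟨l, by omega, hl, rfl⟩, hji⟩)
        · exact Or.inl ⟨fun _ => hm (j - 1) l (by omega) (by omega) (by omega), fun _ => hji⟩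
      · exact Or.inr (Or.inr ⟨hji, hle l (j - 1) (by omega) (by omega) (by omega)⟩)
    · exact hqI z ⟨hxi, le_rfl⟩
  rw [aux_Dk_coeff (x i) t k f q hqd hqI t ⟨hxi, le_rfl⟩]
  rw [aux_divDiff_poly f k _ _ (aux_ctrs_nodup' n x hm _ _ (by omega) hin t fun _ => hxi) q hqd hqC]
  rw [List.length_append, aux_ctrs_len _ _ _ hki]; rfl

open Polynomial in
/-- key step of the converse -/
theorem aux_key (n k i : ℕ) (x : ℕ → ℝ) (d : ℝ)
    (hm : ∀ i j, 1 ≤ i → i < j → j ≤ n → x i < x j) (hk : 1 ≤ k) (hki : k + 1 ≤ i) (hi : i < n)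
    (hd : x i < d) (f : ℝ → ℝ) (q : ℝ[X]) (hq : q.natDegree ≤ k)
    (hf : ∀ s ∈ Set.Ioc (x i) d, f s = q.eval s) (hd' : d ≤ x (i + 1))
    (h : ∀ s ∈ Set.Ioc (x i) d, discreteDeriv x n k f s = Dk k f s) :
    ∀ z ∈ ctrs x (i + 1 - k) i, f z = q.eval z := by
  have hnd := aux_ctrs_nodup n x hm (i + 1 - k) i (by omega) (by omega)
  have hlen := aux_ctrs_len x k i (by omega)
  have key : ∀ s ∈ Set.Ioc (x i) d, ∃ r : ℝ[X], r.degree < k ∧ r.eval s = 0 ∧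
      ∀ z ∈ ctrs x (i + 1 - k) i, f z - q.eval z = r.eval z := by
    intro s hs
    have hidx := aux_idx n x hm s
    have hI : discrIdx x n s = i := by
      apply le_antisymm
      · by_contra hc
        have := (hidx (i + 1) (by omega) (by omega)).2 (by omega)
        exact absurd this (not_lt.2 (hs.2.trans hd'))
      · exact (hidx i (by omega) (by omega)).1 hs.1
    have h1 := h s hs
    rw [aux_discr _ _ _ _ _ (by omega), aux_Dk_coeff (x i) d k f q hq hf s hs, hI] at h1
    have h2 := mul_left_cancel₀ (by positivity) h1
    obtain ⟨r, r1, r2, r3⟩ := aux_interp f k (ctrs x (i + 1 - k) i ++ [s])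
      (by rw [List.length_append, hlen]; rfl)
      (aux_ctrs_nodup' n x hm _ _ (by omega) (by omega) s fun _ => hs.1)
    refine ⟨r - q, ?_, ?_, ?_⟩
    · rw [degree_lt_iff_coeff_zero]
      intro j hj
      rw [coeff_sub]
      rcases eq_or_lt_of_le hj with rfl | hj
      · rw [← r3, h2, sub_self]
      · rw [coeff_eq_zero_of_natDegree_lt (by omega), coeff_eq_zero_of_natDegree_lt (by omega), sub_self]
    · rw [eval_sub, ← r2 s (by simp), hf s hs, sub_self]
    · intro z hz
      rw [eval_sub, ← r2 z (List.mem_append_left _ hz)]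
  obtain ⟨r, r1, r2, r3⟩ := key d ⟨hd, le_rfl⟩
  have hr : r = 0 := by
    apply eq_zero_of_infinite_isRoot
    refine Set.Infinite.mono ?_ (Set.Ioc_infinite hd)
    intro s hs
    obtain ⟨r', r1', r2', r3'⟩ := key s hs
    have : r = r' := by
      apply aux_unique _ hnd
      · rwa [hlen]
      · rwa [hlen]
      · intro z hz; rw [← r3 z hz, r3' z hz]
    rw [this]; exact r2'
  intro z hz
  have := r3 z hz
  rw [hr, eval_zero] at this
  linarith

open Polynomial in
theorem aux_part2 (n k : ℕ) (a b : ℝ) (x : ℕ → ℝ)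
    (hn : k + 2 ≤ n) (hm : ∀ i j, 1 ≤ i → i < j → j ≤ n → x i < x j)
    (ha : a ≤ x 1) (hb : x n ≤ b) (f : ℝ → ℝ) (p : ℕ → ℝ[X])
    (hp : ∀ i ∈ Finset.range (n - k), (p i).natDegree ≤ k)
    (h0 : ∀ t ∈ Set.Icc a (x (k + 1)), f t = (p 0).eval t)
    (h1 : ∀ i ∈ Finset.Icc 1 (n - k - 1),
          ∀ t ∈ Set.Ioc (x (k + i)) (if i = n - k - 1 then b else x (k + i + 1)),
            f t = (p i).eval t)
    (hD : ∀ t : ℝ, x k < t → t ≤ b → discreteDeriv x n k f t = Dk k f t) :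
    inFFSpan x n k a b f := by
  have hle : ∀ l l', 1 ≤ l → l ≤ l' → l' ≤ n → x l ≤ x l' := by
    intro l l' h1 h2 h3
    rcases eq_or_lt_of_le h2 with rfl | h
    · exact le_rfl
    · exact (hm l l' h1 h h3).le
  have hm1 : ∀ l, 1 ≤ l → l ≤ n → a ≤ x l := fun l h1 h2 => ha.trans (hle 1 l le_rfl h1 h2)
  have hub : ∀ m, 1 ≤ m → m ≤ n - k - 1 →
      x (k + m + 1) ≤ (if m = n - k - 1 then b else x (k + m + 1)) := by
    intro m _ _
    split_ifs with h
    · rw [show k + m + 1 = n by omega]; exact hb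
    · exact le_rfl
  have hA : ∀ m, m ≤ n - k - 1 → ∀ l, m + 1 ≤ l → l ≤ k + m + 1 → f (x l) = (p m).eval (x l) := by
    intro m hmn l hl1 hl2
    rcases Nat.eq_zero_or_pos m with rfl | hm0
    · exact h0 _ ⟨hm1 l (by omega) (by omega), hle l _ (by omega) (by omega) (by omega)⟩
    · have hf : ∀ s ∈ Set.Ioc (x (k + m)) (x (k + m + 1)), f s = (p m).eval s := by
        intro s hs
        exact h1 m (Finset.mem_Icc.2 ⟨hm0, hmn⟩) s ⟨hs.1, hs.2.trans (hub m hm0 hmn)⟩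
      have hlt : x (k + m) < x (k + m + 1) := hm _ _ (by omega) (by omega) (by omega)
      rcases eq_or_lt_of_le hl2 with rfl | hl2
      · exact hf _ ⟨hlt, le_rfl⟩
      · have := aux_key n k (k + m) x (x (k + m + 1)) hm (by omega) (by omega) (by omega) hlt f (p m)
          (hp m (Finset.mem_range.2 (by omega))) hf le_rfl (by
            intro s hs
            apply hD
            · exact (hle k (k + m) (by omega) (by omega) (by omega)).trans_lt hs.1
            · exact hs.2.trans ((hle _ n (by omega) (by omega) le_rfl).trans hb))
        exact this _ ((aux_mem_ctrs _ _ _ _).2 ⟨l, by omega, by omega, rfl⟩)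
  set e : ℕ → ℝ := fun m => (p m - p (m - 1)).coeff k with he
  have hB : ∀ m, 1 ≤ m → m ≤ n - k - 1 → p m - p (m - 1) = C (e m) * auxN x (m + 1) (k + m) := by
    intro m hm0 hmn
    rw [← sub_eq_zero]
    have hdeg := aux_sub_deg k (p m - p (m - 1)) (auxN x (m + 1) (k + m))
      ((natDegree_sub_le _ _).trans (max_le (hp m (Finset.mem_range.2 (by omega)))
        (hp (m - 1) (Finset.mem_range.2 (by omega))))) (by rw [auxN_deg]; omega) (auxN_monic _ _ _)
    have hnd := aux_ctrs_nodup n x hm (k + m + 1 - k) (k + m) (by omega) (by omega)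
    have hlen := aux_ctrs_len x k (k + m) (by omega)
    apply aux_unique _ hnd
    · rwa [hlen]
    · rw [degree_zero]; exact WithBot.bot_lt_coe _
    · intro z hz
      obtain ⟨l, g1, g2, rfl⟩ := (aux_mem_ctrs _ _ _ _).1 hz
      rw [eval_sub, eval_sub, eval_mul, auxN_eval,
        Finset.prod_eq_zero (Finset.mem_Icc.2 ⟨by omega, g2⟩) (sub_self _),
        ← hA m hmn l (by omega) (by omega), ← hA (m - 1) (by omega) l (by omega) (by omega)]
      simp
  have hT : ∀ M, M ≤ n - k - 1 → ∀ t, (p M).eval t = (p 0).eval t +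
      ∑ m ∈ Finset.Icc 1 M, e m * ∏ ℓ ∈ Finset.Icc (m + 1) (k + m), (t - x ℓ) := by
    intro M
    induction M with
    | zero => intro _ t; simp
    | succ M ih =>
      intro hM t
      rw [Finset.sum_Icc_succ_top (by omega), ← add_assoc, ← ih (by omega)]
      have := congrArg (eval t) (hB (M + 1) (by omega) hM)
      rw [eval_sub, eval_mul, eval_C, auxN_eval, Nat.add_sub_cancel] at this
      linarith
  obtain ⟨d, hd⟩ := aux_newton x k (p 0) (hp 0 (Finset.mem_range.2 (by omega)))
  refine ⟨fun j => if j ≤ k + 1 then d j else (Nat.factorial k : ℝ) * e (j - (k + 1)), ?_⟩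
  intro t ht
  have hidx := aux_idx n x hm t
  have hin := aux_idx_le n x t
  generalize discrIdx x n t = i at hidx hin
  set M := min (i - k) (n - k - 1) with hM
  have hfM : f t = (p M).eval t := by
    rcases Nat.eq_zero_or_pos M with h | h
    · rw [h]
      apply h0 _ ⟨ht.1, ?_⟩
      by_contra hc
      have := (hidx (k + 1) (by omega) (by omega)).1 (not_le.1 hc)
      omega
    · apply h1 M (Finset.mem_Icc.2 ⟨h, by omega⟩)
      refine ⟨(hidx (k + M) (by omega) (by omega)).2 (by omega), ?_⟩
      split_ifs with hh
      · exact ht.2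
      · by_contra hc
        have := (hidx (k + M + 1) (by omega) (by omega)).1 (not_le.1 hc)
        omega
  rw [hfM, hT M (by omega), hd t]
  have hsplit : Finset.Icc 1 n = Finset.Icc 1 (k + 1) ∪ (Finset.Icc 1 (n - k - 1)).image (· + (k + 1)) := by
    ext j
    simp only [Finset.mem_union, Finset.mem_Icc, Finset.mem_image]
    constructor
    · intro h
      by_cases hj : j ≤ k + 1
      · left; omega
      · right; exact ⟨j - (k + 1), by omega, by omega⟩
    · rintro (h | ⟨l, h, rfl⟩) <;> omega
  rw [hsplit, Finset.sum_union, Finset.sum_image (by intro u _ v _ huv; simpa using huv)]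
  · congr 1
    · apply Finset.sum_congr rfl
      intro j hj
      rw [Finset.mem_Icc] at hj
      simp only [fallFact]
      rw [if_pos hj.2, if_pos hj.2]
    · have hsub : Finset.Icc 1 M ⊆ Finset.Icc 1 (n - k - 1) :=
        Finset.Icc_subset_Icc_right (by omega)
      symm
      rw [← Finset.sum_subset hsub]
      · apply Finset.sum_congr rfl
        intro m hmm
        rw [Finset.mem_Icc] at hmm
        have hx : x (m + (k + 1) - 1) < t := (hidx _ (by omega) (by omega)).2 (by omega)
        simp only [fallFact]
        rw [if_neg (by omega), if_neg (by omega), if_pos hx, Nat.add_sub_cancel,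
          show m + (k + 1) - k = m + 1 by omega, show m + (k + 1) - 1 = k + m by omega]
        have : (Nat.factorial k : ℝ) ≠ 0 := by positivity
        field_simp
      · intro m hmm hm'
        rw [Finset.mem_Icc] at hmm hm'
        have hx : ¬ x (m + (k + 1) - 1) < t := by
          intro hc
          have := (hidx _ (by omega) (by omega)).1 hc
          omega
        simp only [fallFact]
        rw [if_neg (by omega), if_neg (by omega), if_neg hx]
        simp
  · rw [Finset.disjoint_left]
    intro j hj hj'
    simp only [Finset.mem_Icc, Finset.mem_image] at hj hj'
    obtain ⟨l, h, rfl⟩ := hj'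
    omega

/-- Corollary: matching discrete and ordinary derivatives characterize
discrete splines. (i) Every `f ∈ H^k_n` satisfies `(Δ^k_n f)(x) = (D^k f)(x)` for all
`x ∈ (x_k, b]`, where `D^k` is the `k`-th (left) derivative.  (ii) Conversely, a `k`-th
degree piecewise polynomial with knots in `x_{(k+1):(n−1)}` satisfying this matching
property must lie in `H^k_n`. -/
theorem matching_derivatives_characterization
    (n k : ℕ) (a b : ℝ) (x : ℕ → ℝ)
    (hn : k + 2 ≤ n)
    (hmono : ∀ i, 1 ≤ i → i < n → x i < x (i + 1))
    (ha : a ≤ x 1) (hb : x n ≤ b) (hab : x (n + 1) = b) :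
    (∀ f : ℝ → ℝ, inFFSpan x n k a b f →
      ∀ t : ℝ, x k < t → t ≤ b → discreteDeriv x n k f t = Dk k f t) ∧
    (∀ f : ℝ → ℝ,
      (∃ p : ℕ → Polynomial ℝ,
        (∀ i ∈ Finset.range (n - k), (p i).natDegree ≤ k) ∧
        (∀ t ∈ Set.Icc a (x (k + 1)), f t = (p 0).eval t) ∧
        (∀ i ∈ Finset.Icc 1 (n - k - 1),
          ∀ t ∈ Set.Ioc (x (k + i)) (if i = n - k - 1 then b else x (k + i + 1)),
            f t = (p i).eval t)) →
      (∀ t : ℝ, x k < t → t ≤ b → discreteDeriv x n k f t = Dk k f t) →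
      inFFSpan x n k a b f) := by
  have hm := aux_mono n x hmono
  refine ⟨fun f hf t hk ht => aux_part1 n k a b x hn hm ha f hf t hk ht, ?_⟩
  rintro f ⟨p, hp, h0, h1⟩ hD
  exact aux_part2 n k a b x hn hm ha hb f p hp h0 h1 hD
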